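/- Let E be a field of characteristic different from 2. Every anisotropic regular quadratic form of dimension at most 3 over E(X) remains anisotropic over the completion E(X)_v for at least one valuation v ∈ Ω_{E(X)/E}. -/

import Mathlib

open Polynomial

/-- Isotropy of the diagonal quadratic form `⟨a 0, …, a (n-1)⟩`. -/
def IsotropicDiag {R : Type*} [CommRing R] {n : ℕ} (a : Fin n → R) : Prop :=
  ∃ x : Fin n → R, x ≠ 0 ∧ ∑ i, a i * x i ^ 2 = 0

/-- `v` is a ℤ-valuation on `E(X)` (i.e. a valuation with value group exactly ℤ)
which is trivial on `E`. -/
def IsZValuationTrivialOnBase (E : Type*) [Field E]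
    (v : Valuation (RatFunc E) (WithZero (Multiplicative ℤ))) : Prop :=
  Function.Surjective v ∧ ∀ a : Eˣ, v (algebraMap E (RatFunc E) a) = 1

/-- The diagonal form `⟨a 0, …, a (n-1)⟩` is isotropic over the completion of `F`
at the ℤ-valuation `v`. -/
noncomputable def IsotropicCompletion {F : Type*} [Field F]
    (v : Valuation F (WithZero (Multiplicative ℤ))) {n : ℕ} (a : Fin n → F) : Prop :=
  letI : Valued F (WithZero (Multiplicative ℤ)) := Valued.mk' v
  IsotropicDiag (fun i => UniformSpace.Completion.coe' (α := F) (a i))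

open IsDedekindDomain UniformSpace WithZero
open scoped WithZeroTopology

universe u

/-- Isotropy over a completion is isotropy over some field extension. -/
theorem exists_field_isotropicCompletion_iff {F : Type u} [Field F] (v : Valuation F ℤᵐ⁰) :
    ∃ (K : Type u) (_ : Field K) (f : F →+* K), ∀ (n : ℕ) (a : Fin n → F),
      IsotropicCompletion v a ↔ IsotropicDiag (fun i => f (a i)) := by
  let _ : Valued F ℤᵐ⁰ := Valued.mk' v
  exact ⟨Completion F, inferInstance, Completion.coeRingHom, fun n a => Iff.rfl⟩

/-- A form isotropic over the completion has primitive approximate zeros over the base field. -/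
theorem IsotropicCompletion.exists_approx {F : Type*} [Field F] {v : Valuation F ℤᵐ⁰}
    (hv : Function.Surjective v) {n : ℕ} {a : Fin n → F} (h : IsotropicCompletion v a)
    {γ : ℤᵐ⁰} (hγ : γ ≠ 0) :
    ∃ y : Fin n → F, (∀ i, v (y i) ≤ 1) ∧ (∃ i, v (y i) = 1) ∧ v (∑ i, a i * y i ^ 2) < γ := by
  let _ : Valued F ℤᵐ⁰ := Valued.mk' v
  obtain ⟨x, hx, hsum⟩ : IsotropicDiag fun i => (a i : Completion F) := h
  have hsurj : Function.Surjective (Valued.v : Valuation (Completion F) ℤᵐ⁰) :=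
    Valued.valuedCompletion_surjective_iff.mpr hv
  set w : Valuation (Completion F) ℤᵐ⁰ := Valued.v with hw
  have hcoe (y : F) : w (y : Completion F) = v y := Valued.valuedCompletion_apply y
  obtain ⟨j₀, hj₀⟩ := Function.ne_iff.mp hx
  obtain ⟨j, -, hj⟩ := Finset.exists_max_image Finset.univ (fun i => w (x i)) ⟨j₀, by simp⟩
  have hwj : w (x j) ≠ 0 := fun h0 => hj₀ <| by
    simpa [h0] using hj j₀ (by simp)
  have hxj : x j ≠ 0 := by simpa using hwj
  let z : Fin n → Completion F := fun i => x i / x j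
  have hz : ∀ i, w (z i) ≤ 1 := fun i => by
    simpa [z] using div_le_one_of_le₀ (hj i (by simp)) zero_le
  have hzsum : ∑ i, (a i : Completion F) * z i ^ 2 = 0 := by
    simp only [z, div_pow, ← mul_div_assoc, ← Finset.sum_div, hsum, zero_div]
  have hcont : Continuous fun y : Fin n → Completion F => ∑ i, (a i : Completion F) * y i ^ 2 := by
    fun_prop
  have hlt : IsOpen {y : Completion F | w y < γ} :=
    WithZeroTopology.isOpen_Iio.preimage (Valued.continuous_valuation_of_surjective hsurj)
  have hle : IsOpen {y : Completion F | w y ≤ 1} := Valued.isOpen_integer (Completion F)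
  have heq : IsOpen {y : Completion F | w y = 1} :=
    (WithZeroTopology.isOpen_iff.mpr (.inl (by simp)) : IsOpen {(1 : ℤᵐ⁰)}).preimage
      (Valued.continuous_valuation_of_surjective hsurj)
  have hproj (i : Fin n) : Continuous fun y : Fin n → Completion F => y i := continuous_apply i
  have hU₁ : IsOpen {y : Fin n → Completion F | ∀ i, w (y i) ≤ 1} := by
    rw [Set.ofPred_forall]
    exact isOpen_iInter_of_finite fun i => hle.preimage (hproj i)
  have hU₂ : IsOpen {y : Fin n → Completion F | w (y j) = 1} := heq.preimage (hproj j)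
  have hU₃ : IsOpen {y : Fin n → Completion F | w (∑ i, (a i : Completion F) * y i ^ 2) < γ} :=
    hlt.preimage hcont
  have hdense : DenseRange (Pi.map fun _ : Fin n => ((↑) : F → Completion F)) :=
    DenseRange.piMap fun _ => Completion.denseRange_coe
  obtain ⟨y, hy, hyj, hysum⟩ := hdense.exists_mem_open (hU₁.inter (hU₂.inter hU₃))
    ⟨z, hz, by simp [z, hxj], by simpa [hzsum, zero_lt_iff] using hγ⟩
  let φ : F →+* Completion F := Completion.coeRingHom
  have hys : ((∑ i, a i * y i ^ 2 : F) : Completion F) =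
      ∑ i, (a i : Completion F) * (y i : Completion F) ^ 2 := by
    change φ _ = ∑ i, φ (a i) * φ (y i) ^ 2
    simp only [map_sum, map_mul, map_pow]
  refine ⟨y, fun i => ?_, ⟨j, ?_⟩, ?_⟩
  · rw [← hcoe]; exact hy i
  · rw [← hcoe]; exact hyj
  · rw [← hcoe, hys]; exact hysum

/-- The height one prime of a principal ideal domain generated by an irreducible element. -/
def IsDedekindDomain.HeightOneSpectrum.ofIrreducible {R : Type*} [CommRing R] [IsDomain R]
    [IsPrincipalIdealRing R] {p : R} (hp : Irreducible p) : HeightOneSpectrum R where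
  asIdeal := Ideal.span {p}
  isPrime := (Ideal.span_singleton_prime hp.ne_zero).mpr hp.prime
  ne_bot := by simpa using hp.ne_zero

/-- The valuation of a fraction field attached to an irreducible element. -/
noncomputable abbrev Irreducible.valuation {R : Type*} [CommRing R] [IsDomain R]
    [IsPrincipalIdealRing R] {p : R} (hp : Irreducible p) (F : Type*) [Field F] [Algebra R F]
    [IsFractionRing R F] : Valuation F ℤᵐ⁰ :=
  (HeightOneSpectrum.ofIrreducible hp).valuation F

/-- A form over a principal ideal domain that is isotropic over the `p`-adic completion has
primitive zeros modulo every power of `p`. -/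
theorem IsotropicCompletion.exists_pow_dvd {R : Type*} [CommRing R] [IsDomain R]
    [IsPrincipalIdealRing R] {F : Type*} [Field F] [Algebra R F]
    [IsFractionRing R F] {p : R} (hp : Irreducible p) {n : ℕ} {a : Fin n → R}
    (h : IsotropicCompletion (hp.valuation F) fun i => algebraMap R F (a i)) (k : ℕ) :
    ∃ x : Fin n → R, (∃ i, ¬ p ∣ x i) ∧ p ^ k ∣ ∑ i, a i * x i ^ 2 := by
  obtain ⟨y, hy, ⟨j, hj⟩, hsum⟩ := h.exists_approx (HeightOneSpectrum.valuation_surjective F _)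
    (γ := exp (-(k : ℤ))) (by simp)
  let P := HeightOneSpectrum.ofIrreducible hp
  choose m d hmd using fun i => P.exists_primeCompl_mul_eq_of_integer _ (hy i)
  let D : R := ∏ i, (d i : R)
  have hvd (i) : P.valuation F (algebraMap R F (d i)) = 1 :=
    HeightOneSpectrum.valuation_eq_one_iff_notMem _ |>.mpr (d i).2
  have hvD : P.valuation F (algebraMap R F D) = 1 := by
    simp [D, map_prod, hvd]
  have hx (i) : algebraMap R F (m i * ∏ l ∈ Finset.univ.erase i, (d l : R)) =
      y i * algebraMap R F D := by
    rw [map_mul, ← hmd, mul_assoc, ← map_mul,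
      Finset.mul_prod_erase _ (fun l => (d l : R)) (Finset.mem_univ i)]
  refine ⟨fun i => m i * ∏ l ∈ Finset.univ.erase i, (d l : R), ⟨j, ?_⟩, ?_⟩
  · rw [← Ideal.mem_span_singleton]
    refine (HeightOneSpectrum.valuation_eq_one_iff_notMem (K := F) P).mp ?_
    rw [hx, map_mul, hvD, mul_one, hj]
  · rw [← Ideal.mem_span_singleton, ← Ideal.span_singleton_pow]
    refine (P.intValuation_le_pow_iff_mem _ k).mp ?_
    rw [← HeightOneSpectrum.valuation_of_algebraMap (K := F)]
    have : algebraMap R F (∑ i, a i * (m i * ∏ l ∈ Finset.univ.erase i, (d l : R)) ^ 2) =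
        algebraMap R F D ^ 2 * ∑ i, algebraMap R F (a i) * y i ^ 2 := by
      rw [map_sum, Finset.mul_sum]
      refine Finset.sum_congr rfl fun i _ => ?_
      rw [map_mul, map_pow, hx]
      ring
    refine (congrArg (P.valuation F) this).trans_le ?_
    rw [map_mul, map_pow, hvD, one_pow, one_mul]
    exact hsum.le

/-- The equation `x ^ 2 = a * y ^ 2 + b * z ^ 2` has a nonzero solution. -/
def HasTernaryZero {K : Type*} [CommRing K] (a b : K) : Prop :=
  ∃ x y z : K, ¬(x = 0 ∧ y = 0 ∧ z = 0) ∧ x ^ 2 = a * y ^ 2 + b * z ^ 2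

namespace HasTernaryZero

theorem symm {K : Type*} [CommRing K] {a b : K} (h : HasTernaryZero a b) :
    HasTernaryZero b a := by
  obtain ⟨x, y, z, h0, h⟩ := h
  exact ⟨x, z, y, by tauto, by rw [h, add_comm]⟩

theorem map {K L : Type*} [CommRing K] [CommRing L] {f : K →+* L} (hf : Function.Injective f)
    {a b : K} (h : HasTernaryZero a b) : HasTernaryZero (f a) (f b) := by
  obtain ⟨x, y, z, h0, h⟩ := h
  exact ⟨f x, f y, f z, by simpa [map_eq_zero_iff f hf] using h0, by simp [← map_pow, h]⟩

variable {K : Type*} [Field K] {a b b' s c : K}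

theorem of_sq (h : a = c ^ 2) : HasTernaryZero a b :=
  ⟨c, 1, 0, by simp, by simp [h]⟩

theorem mul_sq_right_iff (hs : s ≠ 0) : HasTernaryZero a (b * s ^ 2) ↔ HasTernaryZero a b := by
  constructor
  · rintro ⟨x, y, z, h0, h⟩
    exact ⟨x, y, s * z, by simpa [hs] using h0, by rw [h]; ring⟩
  · rintro ⟨x, y, z, h0, h⟩
    exact ⟨x, y, z / s, by simpa [hs] using h0, by rw [h]; field_simp⟩

theorem mul_sq_left_iff (hs : s ≠ 0) : HasTernaryZero (a * s ^ 2) b ↔ HasTernaryZero a b :=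
  ⟨fun h => ((mul_sq_right_iff hs).mp h.symm).symm,
    fun h => ((mul_sq_right_iff hs).mpr h.symm).symm⟩

/-- Norms from the quadratic extension by a square root of `a` act on solutions. -/
theorem of_mul_eq_norm (hb : b ≠ 0) (hb' : b' ≠ 0) (h : b * b' = c ^ 2 - a)
    (hab : HasTernaryZero a b) : HasTernaryZero a b' := by
  obtain ⟨x, y, z, h0, hxyz⟩ := hab
  refine ⟨c * x + a * y, x + c * y, b * z, fun ⟨h₁, h₂, h₃⟩ => h0 ?_, ?_⟩
  · have hz : z = 0 := by simpa [hb] using h₃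
    have hy : b * b' * y = 0 := by rw [h]; linear_combination c * h₂ - h₁
    have hy : y = 0 := by simpa [hb, hb'] using hy
    exact ⟨by simpa [hy] using h₂, hy, hz⟩
  · linear_combination (c ^ 2 - a) * hxyz - b * z ^ 2 * h

end HasTernaryZero

theorem isotropicDiag_three_iff {K : Type*} [Field K] {a : Fin 3 → K} (h0 : a 0 ≠ 0) :
    IsotropicDiag a ↔ HasTernaryZero (-(a 0 * a 1)) (-(a 0 * a 2)) := by
  constructor
  · rintro ⟨x, hx, h⟩
    rw [Fin.sum_univ_three] at h
    refine ⟨a 0 * x 0, x 1, x 2, fun ⟨h₁, h₂, h₃⟩ => hx ?_, by linear_combination a 0 * h⟩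
    ext i
    fin_cases i
    · simpa [h0] using h₁
    · exact h₂
    · exact h₃
  · rintro ⟨x, y, z, hx, h⟩
    refine ⟨![x / a 0, y, z], fun h' => hx ⟨?_, ?_, ?_⟩, ?_⟩
    · simpa [h0] using congrFun h' 0
    · simpa using congrFun h' 1
    · simpa using congrFun h' 2
    · simp only [Fin.sum_univ_three, Matrix.cons_val]
      field_simp
      linear_combination h

theorem isotropicDiag_two_iff {K : Type*} [Field K] {a : Fin 2 → K} (h0 : a 0 ≠ 0) :
    IsotropicDiag a ↔ IsSquare (-(a 0 * a 1)) := by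
  constructor
  · rintro ⟨x, hx, h⟩
    rw [Fin.sum_univ_two] at h
    have h1 : x 1 ≠ 0 := fun h1 => hx <| by
      ext i
      fin_cases i
      · simpa [h1, h0] using h
      · exact h1
    refine ⟨a 0 * x 0 / x 1, ?_⟩
    field_simp
    linear_combination - h
  · rintro ⟨c, hc⟩
    refine ⟨![c, a 0], fun h' => h0 (by simpa using congrFun h' 1), ?_⟩
    simp only [Fin.sum_univ_two, Matrix.cons_val]
    linear_combination -a 0 * hc

theorem not_isotropicDiag_of_le_one {K : Type*} [Field K] {n : ℕ} (hn : n ≤ 1) {a : Fin n → K}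
    (ha : ∀ i, a i ≠ 0) : ¬ IsotropicDiag a := by
  have : Subsingleton (Fin n) := Fin.subsingleton_iff_le_one.mpr hn
  rintro ⟨x, hx, h⟩
  obtain ⟨j, hj⟩ := Function.ne_iff.mp hx
  rw [Fintype.sum_subsingleton _ j] at h
  exact hj (by simpa [ha j] using h)

/-- Isotropy of binary and ternary forms over a completion, expressed in normal form over a
common field extension. -/
theorem exists_field_completion_normal_form {F : Type u} [Field F] (v : Valuation F ℤᵐ⁰) :
    ∃ (K : Type u) (_ : Field K) (f : F →+* K),
      (∀ a : Fin 2 → F, a 0 ≠ 0 →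
        (IsotropicCompletion v a ↔ IsSquare (f (-(a 0 * a 1))))) ∧
      (∀ a : Fin 3 → F, a 0 ≠ 0 →
        (IsotropicCompletion v a ↔ HasTernaryZero (f (-(a 0 * a 1))) (f (-(a 0 * a 2))))) := by
  obtain ⟨K, _, f, hf⟩ := exists_field_isotropicCompletion_iff v
  refine ⟨K, _, f, fun a h0 => ?_, fun a h0 => ?_⟩
  · rw [hf, isotropicDiag_two_iff (by simpa using h0)]
    simp
  · rw [hf, isotropicDiag_three_iff (by simpa using h0)]
    simp

/-- Being a square modulo a squarefree element can be tested modulo its irreducible factors. -/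
theorem Squarefree.exists_dvd_sq_sub {R : Type*} [CommRing R] [IsDomain R]
    [IsPrincipalIdealRing R] {a b : R} (hb : Squarefree b)
    (h : ∀ p, Irreducible p → p ∣ b → ∃ c, p ∣ c ^ 2 - a) : ∃ c, b ∣ c ^ 2 - a := by
  induction b using WfDvdMonoid.induction_on_irreducible with
  | zero => exact absurd hb not_squarefree_zero
  | unit u hu => exact ⟨0, hu.dvd⟩
  | mul b p _ hp ih =>
    obtain ⟨c₁, hc₁⟩ := h p hp (dvd_mul_right p b)
    obtain ⟨c₂, hc₂⟩ := ih (hb.squarefree_of_dvd (dvd_mul_left b p))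
      fun q hq hqb => h q hq (hqb.mul_left p)
    have hpb : IsCoprime p b := hp.coprime_iff_not_dvd.mpr fun hpb =>
      hp.not_isUnit (hb p (mul_dvd_mul_left p hpb))
    obtain ⟨u, w, huw⟩ := hpb
    refine ⟨c₂ * (u * p) + c₁ * (w * b), IsCoprime.mul_dvd ⟨u, w, huw⟩ ?_ ?_⟩
    · have h₁ : c₂ * (u * p) + c₁ * (w * b) - c₁ = p * (u * (c₂ - c₁)) := by
        linear_combination c₁ * huw
      convert dvd_add hc₁ (((Dvd.intro _ h₁.symm).mul_right (c₂ * (u * p) + c₁ * (w * b) + c₁)))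
        using 1
      ring
    · have h₁ : c₂ * (u * p) + c₁ * (w * b) - c₂ = b * (w * (c₁ - c₂)) := by
        linear_combination c₂ * huw
      convert dvd_add hc₂ (((Dvd.intro _ h₁.symm).mul_right (c₂ * (u * p) + c₁ * (w * b) + c₂)))
        using 1
      ring

theorem exists_dvd_sq_sub_of_primitive_zero {R : Type*} [CommRing R] [IsDomain R]
    [IsPrincipalIdealRing R] {a b p x y z : R} (hp : Irreducible p) (hb : Squarefree b)
    (hpb : p ∣ b) (hprim : ¬(p ∣ x ∧ p ∣ y ∧ p ∣ z))
    (h : p ^ 2 ∣ x ^ 2 - a * y ^ 2 - b * z ^ 2) : ∃ c, p ∣ c ^ 2 - a := by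
  have hp' := hp.prime
  have h₁ : p ∣ x ^ 2 - a * y ^ 2 := by
    convert dvd_add ((dvd_pow_self p two_ne_zero).trans h) (hpb.mul_right (z ^ 2)) using 1
    ring
  by_cases hy : p ∣ y
  · have hx : p ∣ x := hp'.dvd_of_dvd_pow (n := 2) <| by
      convert dvd_add h₁ ((dvd_pow hy two_ne_zero).mul_left a) using 1
      ring
    have hz : p ^ 2 ∣ b * z ^ 2 := by
      convert dvd_sub (dvd_sub (pow_dvd_pow_of_dvd hx 2)
        ((pow_dvd_pow_of_dvd hy 2).mul_left a)) h using 1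
      ring
    obtain ⟨e, rfl⟩ := hpb
    rw [pow_two, mul_assoc] at hz
    refine (hprim ⟨hx, hy, ?_⟩).elim
    refine ((hp'.dvd_or_dvd ((mul_dvd_mul_iff_left hp.ne_zero).mp hz)).resolve_left fun he => ?_)
      |> hp'.dvd_of_dvd_pow
    exact hp.not_isUnit (hb p (mul_dvd_mul_left p he))
  · obtain ⟨u, w, huw⟩ := hp.coprime_iff_not_dvd.mpr hy
    refine ⟨x * w, ?_⟩
    have : (x * w) ^ 2 - a = (x ^ 2 - a * y ^ 2) * w ^ 2 - p * (a * u * (w * y + 1)) := by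
      linear_combination a * (w * y + 1) * huw
    rw [this]
    exact dvd_sub (h₁.mul_right _) (dvd_mul_right _ _)

section Polynomial

variable {E : Type u} [Field E]

/-- The form `⟨1, -a, -b⟩` is isotropic over the completion of `E(X)` at the irreducible
polynomial `p`. -/
def TernaryIsotropicAt {p : E[X]} (hp : Irreducible p) (a b : E[X]) : Prop :=
  IsotropicCompletion (hp.valuation (RatFunc E)) fun i =>
    algebraMap E[X] (RatFunc E) (![1, -a, -b] i)

theorem TernaryIsotropicAt.exists_primitive_zero {p a b : E[X]} {hp : Irreducible p}
    (h : TernaryIsotropicAt hp a b) : ∃ x y z : E[X], ¬(p ∣ x ∧ p ∣ y ∧ p ∣ z) ∧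
      p ^ 2 ∣ x ^ 2 - a * y ^ 2 - b * z ^ 2 := by
  obtain ⟨x, ⟨i, hi⟩, hx⟩ := IsotropicCompletion.exists_pow_dvd hp h 2
  refine ⟨x 0, x 1, x 2, fun ⟨h₀, h₁, h₂⟩ => hi ?_, ?_⟩
  · fin_cases i <;> assumption
  · simpa [Fin.sum_univ_three, sub_eq_add_neg] using hx

theorem exists_field_ternaryIsotropicAt_iff {p : E[X]} (hp : Irreducible p) :
    ∃ (K : Type u) (_ : Field K) (f : E[X] →+* K), Function.Injective f ∧ ∀ a b,
      TernaryIsotropicAt hp a b ↔ HasTernaryZero (f a) (f b) := by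
  obtain ⟨K, _, f, -, hf⟩ := exists_field_completion_normal_form (hp.valuation (RatFunc E))
  refine ⟨K, _, f.comp (algebraMap E[X] (RatFunc E)),
    f.injective.comp (RatFunc.algebraMap_injective E), fun a b => ?_⟩
  rw [TernaryIsotropicAt, hf _ (by simp)]
  simp

theorem hasTernaryZero_C_of_isotropicAt_X {α β : E}
    (h : TernaryIsotropicAt (irreducible_X : Irreducible (X : E[X])) (C α) (C β)) :
    HasTernaryZero α β := by
  obtain ⟨x, y, z, h0, hxyz⟩ := h.exists_primitive_zero
  simp only [X_dvd_iff, coeff_zero_eq_eval_zero] at h0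
  refine ⟨x.eval 0, y.eval 0, z.eval 0, h0, ?_⟩
  have := X_dvd_iff.mp ((dvd_pow_self X two_ne_zero).trans hxyz)
  simp only [coeff_zero_eq_eval_zero, eval_sub, eval_mul, eval_pow, eval_C] at this
  linear_combination this

/-- Local-global principle for the forms `⟨1, -a, -b⟩` with polynomial coefficients. -/
theorem hasTernaryZero_of_forall_isotropicAt {a b : E[X]} (ha : a ≠ 0) (hb : b ≠ 0)
    (h : ∀ p (hp : Irreducible p), TernaryIsotropicAt hp a b) :
    HasTernaryZero (algebraMap E[X] (RatFunc E) a) (algebraMap E[X] (RatFunc E) b) := by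
  induction hN : a.natDegree + b.natDegree using Nat.strong_induction_on generalizing a b with
  | _ N ih =>
  wlog hab : a.natDegree ≤ b.natDegree generalizing a b
  · refine (this hb ha (fun p hp => ?_) (by omega) (by omega)).symm
    obtain ⟨K, _, f, -, hf⟩ := exists_field_ternaryIsotropicAt_iff hp
    exact (hf _ _).mpr ((hf _ _).mp (h p hp)).symm
  have hinj := RatFunc.algebraMap_injective E
  obtain hb0 | hb0 := Nat.eq_zero_or_pos b.natDegree
  · obtain ⟨α, rfl⟩ := natDegree_eq_zero.mp (show a.natDegree = 0 by omega)
    obtain ⟨β, rfl⟩ := natDegree_eq_zero.mp hb0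
    exact (hasTernaryZero_C_of_isotropicAt_X (h X irreducible_X)).map
      (f := (algebraMap E[X] (RatFunc E)).comp C) (hinj.comp C_injective)
  by_cases hsq : Squarefree b
  · have hlocal : ∀ p, Irreducible p → p ∣ b → ∃ c, p ∣ c ^ 2 - a := fun p hp hpb => by
      obtain ⟨x, y, z, hprim, hxyz⟩ := (h p hp).exists_primitive_zero
      exact exists_dvd_sq_sub_of_primitive_zero hp hsq hpb hprim hxyz
    obtain ⟨c₀, hc₀⟩ := hsq.exists_dvd_sq_sub hlocal
    set c := c₀ % b with hc
    have hcb : b ∣ c ^ 2 - a := by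
      have : c ^ 2 - a = c₀ ^ 2 - a - b * (c₀ / b * (c₀ + c)) := by
        linear_combination (c₀ + c) * EuclideanDomain.div_add_mod c₀ b
      rw [this]
      exact dvd_sub hc₀ (dvd_mul_right _ _)
    obtain ⟨b', hb'⟩ := hcb
    by_cases hbne : b' = 0
    · refine .of_sq (c := algebraMap E[X] (RatFunc E) c) ?_
      rw [← map_pow, ← sub_eq_zero.mp (hb'.trans (by rw [hbne, mul_zero]))]
    have hcdeg : c.natDegree < b.natDegree := natDegree_mod_lt c₀ hb0.ne'
    have hdeg : b.natDegree + b'.natDegree ≤ max (2 * c.natDegree) a.natDegree := by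
      rw [← natDegree_mul hb hbne, ← hb']
      refine (natDegree_sub_le _ _).trans (max_le_max ?_ le_rfl)
      exact natDegree_pow_le
    have key := ih (a.natDegree + b'.natDegree) (by omega) ha hbne (fun p hp => ?_) rfl
    · refine key.of_mul_eq_norm (c := algebraMap E[X] (RatFunc E) c) ?_ ?_ ?_
      · simpa using hbne
      · simpa using hb
      · rw [mul_comm, ← map_mul, ← hb']; simp
    · obtain ⟨K, _, f, hfi, hf⟩ := exists_field_ternaryIsotropicAt_iff hp
      refine (hf _ _).mpr (((hf _ _).mp (h p hp)).of_mul_eq_norm (c := f c) ?_ ?_ ?_)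
      · simpa [map_eq_zero_iff f hfi] using hb
      · simpa [map_eq_zero_iff f hfi] using hbne
      · rw [← map_mul, ← hb']; simp
  · obtain ⟨d, hd, hdu⟩ : ∃ d, d * d ∣ b ∧ ¬ IsUnit d := by
      simpa [Squarefree] using hsq
    obtain ⟨e, rfl⟩ := hd
    have he : e ≠ 0 := right_ne_zero_of_mul hb
    have hd0 : d ≠ 0 := left_ne_zero_of_mul (left_ne_zero_of_mul hb)
    have hdeg := natDegree_pos_iff_degree_pos.mpr (degree_pos_of_ne_zero_of_nonunit hd0 hdu)
    rw [natDegree_mul (mul_ne_zero hd0 hd0) he, natDegree_mul hd0 hd0] at hN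
    have hde : d * d * e = e * d ^ 2 := by ring
    rw [hde] at h ⊢
    rw [map_mul, map_pow, HasTernaryZero.mul_sq_right_iff (by simpa using hd0)]
    refine ih (a.natDegree + e.natDegree) (by omega) ha he (fun p hp => ?_) rfl
    obtain ⟨K, _, f, hfi, hf⟩ := exists_field_ternaryIsotropicAt_iff hp
    have := (hf _ _).mp (h p hp)
    rw [map_mul, map_pow, HasTernaryZero.mul_sq_right_iff
      (by simpa [map_eq_zero_iff f hfi] using hd0)] at this
    exact (hf _ _).mpr this

/-- The form `⟨1, -d⟩` is isotropic over the completion of `E(X)` at the irreducible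
polynomial `p`. -/
def BinaryIsotropicAt {p : E[X]} (hp : Irreducible p) (d : E[X]) : Prop :=
  IsotropicCompletion (hp.valuation (RatFunc E)) fun i =>
    algebraMap E[X] (RatFunc E) (![1, -d] i)

theorem BinaryIsotropicAt.exists_primitive_zero {p d : E[X]} {hp : Irreducible p}
    (h : BinaryIsotropicAt hp d) : ∃ x y : E[X], ¬(p ∣ x ∧ p ∣ y) ∧
      p ^ 2 ∣ x ^ 2 - d * y ^ 2 := by
  obtain ⟨x, ⟨i, hi⟩, hx⟩ := IsotropicCompletion.exists_pow_dvd hp h 2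
  refine ⟨x 0, x 1, fun ⟨h₀, h₁⟩ => hi ?_, ?_⟩
  · fin_cases i <;> assumption
  · simpa [sub_eq_add_neg] using hx

theorem exists_field_binaryIsotropicAt_iff {p : E[X]} (hp : Irreducible p) :
    ∃ (K : Type u) (_ : Field K) (f : E[X] →+* K), Function.Injective f ∧ ∀ d,
      BinaryIsotropicAt hp d ↔ IsSquare (f d) := by
  obtain ⟨K, _, f, hf, -⟩ := exists_field_completion_normal_form (hp.valuation (RatFunc E))
  refine ⟨K, _, f.comp (algebraMap E[X] (RatFunc E)),
    f.injective.comp (RatFunc.algebraMap_injective E), fun d => ?_⟩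
  rw [BinaryIsotropicAt, hf _ (by simp)]
  simp

theorem isSquare_mul_sq_iff {K : Type*} [Field K] {d s : K} (hs : s ≠ 0) :
    IsSquare (d * s ^ 2) ↔ IsSquare d := by
  constructor
  · rintro ⟨c, hc⟩
    refine ⟨c / s, ?_⟩
    field_simp
    linear_combination hc
  · exact fun h => h.mul (IsSquare.sq s)

/-- Local-global principle for squares of `E(X)`, for polynomials. -/
theorem isSquare_of_forall_isotropicAt {d : E[X]} (hd : d ≠ 0)
    (h : ∀ p (hp : Irreducible p), BinaryIsotropicAt hp d) :
    IsSquare (algebraMap E[X] (RatFunc E) d) := by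
  induction hN : d.natDegree using Nat.strong_induction_on generalizing d with
  | _ N ih =>
  by_cases hsq : Squarefree d
  · by_cases hu : IsUnit d
    · obtain ⟨δ, hδ, rfl⟩ := isUnit_iff.mp hu
      obtain ⟨x, y, h0, hxy⟩ := (h X irreducible_X).exists_primitive_zero
      have hxy := X_dvd_iff.mp ((dvd_pow_self X two_ne_zero).trans hxy)
      simp only [X_dvd_iff, coeff_zero_eq_eval_zero] at h0
      simp only [coeff_zero_eq_eval_zero, eval_sub, eval_mul, eval_pow, eval_C] at hxy
      have hy : y.eval 0 ≠ 0 := fun hy => h0 ⟨by simpa [hy] using hxy, hy⟩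
      have : IsSquare δ := ⟨x.eval 0 / y.eval 0, by field_simp; linear_combination -hxy⟩
      exact (this.map C).map (algebraMap E[X] (RatFunc E))
    · obtain ⟨p, hp, hpd⟩ := WfDvdMonoid.exists_irreducible_factor hu hd
      obtain ⟨x, y, h0, hxy⟩ := (h p hp).exists_primitive_zero
      have hx : p ∣ x := hp.prime.dvd_of_dvd_pow (n := 2) <| by
        convert dvd_add ((dvd_pow_self p two_ne_zero).trans hxy) (hpd.mul_right (y ^ 2)) using 1
        ring
      have hy : p ^ 2 ∣ d * y ^ 2 := by
        convert dvd_sub (pow_dvd_pow_of_dvd hx 2) hxy using 1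
        ring
      obtain ⟨e, rfl⟩ := hpd
      rw [pow_two, mul_assoc] at hy
      refine (h0 ⟨hx, hp.prime.dvd_of_dvd_pow (n := 2) ?_⟩).elim
      refine (hp.prime.dvd_or_dvd ((mul_dvd_mul_iff_left hp.ne_zero).mp hy)).resolve_left fun he => ?_
      exact hp.not_isUnit (hsq p (mul_dvd_mul_left p he))
  · obtain ⟨s, hs, hsu⟩ : ∃ s, s * s ∣ d ∧ ¬ IsUnit s := by
      simpa [Squarefree] using hsq
    obtain ⟨e, rfl⟩ := hs
    have he : e ≠ 0 := right_ne_zero_of_mul hd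
    have hs0 : s ≠ 0 := left_ne_zero_of_mul (left_ne_zero_of_mul hd)
    have hdeg := natDegree_pos_iff_degree_pos.mpr (degree_pos_of_ne_zero_of_nonunit hs0 hsu)
    rw [natDegree_mul (mul_ne_zero hs0 hs0) he, natDegree_mul hs0 hs0] at hN
    have hse : s * s * e = e * s ^ 2 := by ring
    rw [hse] at h ⊢
    rw [map_mul, map_pow, isSquare_mul_sq_iff (by simpa using hs0)]
    refine ih e.natDegree (by omega) he (fun p hp => ?_) rfl
    obtain ⟨K, _, f, hfi, hf⟩ := exists_field_binaryIsotropicAt_iff hp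
    have := (hf _).mp (h p hp)
    rw [map_mul, map_pow, isSquare_mul_sq_iff (by simpa [map_eq_zero_iff f hfi] using hs0)] at this
    exact (hf _).mpr this

/-- Every rational function is a polynomial up to a square. -/
theorem RatFunc.exists_algebraMap_eq_mul_sq {u : RatFunc E} (hu : u ≠ 0) :
    ∃ (A : E[X]) (s : RatFunc E), A ≠ 0 ∧ s ≠ 0 ∧ algebraMap E[X] (RatFunc E) A = u * s ^ 2 := by
  have hden : algebraMap E[X] (RatFunc E) u.denom ≠ 0 := by simpa using u.denom_ne_zero
  refine ⟨u.num * u.denom, algebraMap E[X] (RatFunc E) u.denom,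
    mul_ne_zero (RatFunc.num_ne_zero hu) u.denom_ne_zero, hden, ?_⟩
  nth_rewrite 3 [← RatFunc.num_div_denom u]
  rw [map_mul]
  field_simp

theorem isotropicDiag_of_forall_isotropicCompletion_two {a : Fin 2 → RatFunc E}
    (ha : ∀ i, a i ≠ 0)
    (h : ∀ (p : E[X]) (hp : Irreducible p), IsotropicCompletion (hp.valuation (RatFunc E)) a) :
    IsotropicDiag a := by
  rw [isotropicDiag_two_iff (ha 0)]
  obtain ⟨d, s, hd, hs, hds⟩ := RatFunc.exists_algebraMap_eq_mul_sq (E := E)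
    (neg_ne_zero.mpr (mul_ne_zero (ha 0) (ha 1)))
  rw [← isSquare_mul_sq_iff hs, ← hds]
  refine isSquare_of_forall_isotropicAt hd fun p hp => ?_
  obtain ⟨K, _, f, hf, -⟩ := exists_field_completion_normal_form (hp.valuation (RatFunc E))
  have hsq := (hf a (ha 0)).mp (h p hp)
  rw [← isSquare_mul_sq_iff ((map_ne_zero f).mpr hs), ← map_pow, ← map_mul, ← hds] at hsq
  exact (hf _ (by simp)).mpr (by simpa using hsq)

theorem isotropicDiag_of_forall_isotropicCompletion_three {a : Fin 3 → RatFunc E}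
    (ha : ∀ i, a i ≠ 0)
    (h : ∀ (p : E[X]) (hp : Irreducible p), IsotropicCompletion (hp.valuation (RatFunc E)) a) :
    IsotropicDiag a := by
  rw [isotropicDiag_three_iff (ha 0)]
  obtain ⟨A, s, hA, hs, hAs⟩ := RatFunc.exists_algebraMap_eq_mul_sq (E := E)
    (neg_ne_zero.mpr (mul_ne_zero (ha 0) (ha 1)))
  obtain ⟨B, t, hB, ht, hBt⟩ := RatFunc.exists_algebraMap_eq_mul_sq (E := E)
    (neg_ne_zero.mpr (mul_ne_zero (ha 0) (ha 2)))
  rw [← HasTernaryZero.mul_sq_left_iff hs, ← HasTernaryZero.mul_sq_right_iff ht, ← hAs, ← hBt]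
  refine hasTernaryZero_of_forall_isotropicAt hA hB fun p hp => ?_
  obtain ⟨K, _, f, -, hf⟩ := exists_field_completion_normal_form (hp.valuation (RatFunc E))
  have hz := (hf a (ha 0)).mp (h p hp)
  rw [← HasTernaryZero.mul_sq_left_iff ((map_ne_zero f).mpr hs),
    ← HasTernaryZero.mul_sq_right_iff ((map_ne_zero f).mpr ht), ← map_pow, ← map_mul,
    ← map_pow, ← map_mul, ← hAs, ← hBt] at hz
  exact (hf _ (by simp)).mpr (by simpa using hz)

theorem Irreducible.isZValuationTrivialOnBase {p : E[X]} (hp : Irreducible p) :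
    IsZValuationTrivialOnBase E (hp.valuation (RatFunc E)) := by
  refine ⟨HeightOneSpectrum.valuation_surjective _ _, fun a => ?_⟩
  rw [IsScalarTower.algebraMap_apply E E[X] (RatFunc E)]
  refine (HeightOneSpectrum.valuation_eq_one_iff_notMem _).mpr fun hmem => ?_
  exact (HeightOneSpectrum.ofIrreducible hp).isPrime.ne_top
    (Ideal.eq_top_of_isUnit_mem _ hmem (a.isUnit.map (algebraMap E E[X])))

end Polynomial

/-- Every anisotropic regular quadratic form of dimension at most 3 over `E(X)` remains
anisotropic over the completion `E(X)_v` for at least one `v ∈ Ω_{E(X)/E}`. -/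
theorem statement5 (E : Type*) [Field E] (hchar : ringChar E ≠ 2)
    (n : ℕ) (hn : n ≤ 3) (a : Fin n → RatFunc E) (ha : ∀ i, a i ≠ 0)
    (hanis : ¬ IsotropicDiag a) :
    ∃ v : Valuation (RatFunc E) (WithZero (Multiplicative ℤ)),
      IsZValuationTrivialOnBase E v ∧ ¬ IsotropicCompletion v a := by
  by_contra! hcon
  have h : ∀ (p : E[X]) (hp : Irreducible p), IsotropicCompletion (hp.valuation (RatFunc E)) a :=
    fun p hp => hcon _ hp.isZValuationTrivialOnBase
  obtain hn1 | rfl | rfl : n ≤ 1 ∨ n = 2 ∨ n = 3 := by omega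
  · obtain ⟨K, _, f, hf⟩ := exists_field_isotropicCompletion_iff
      ((irreducible_X : Irreducible (X : E[X])).valuation (RatFunc E))
    exact not_isotropicDiag_of_le_one hn1 (fun i => (map_ne_zero f).mpr (ha i))
      ((hf n a).mp (h X irreducible_X))
  · exact hanis (isotropicDiag_of_forall_isotropicCompletion_two ha h)
  · exact hanis (isotropicDiag_of_forall_isotropicCompletion_three ha h)
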